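/- Let V = ℂ⁴ and consider on ⋀²V the symmetric bilinear form B(w, w') given by w ∧ w' ∈ ⋀⁴V ≅ ℂ (the Plücker quadric G : w ∧ w = 0). A 3-dimensional linear subspace M ⊆ ⋀²V satisfies w ∧ w' = 0 for all w, w' ∈ M if and only if either M = {v ∧ x : x ∈ V} for some nonzero v ∈ V, or M is the image of ⋀²H for some 3-dimensional subspace H ⊆ V. Hence the maximal totally isotropic subspaces of the Plücker quadric form two families, parameterized respectively by points of P(V) and by hyperplanes of P(V). -/

import Mathlib

open ExteriorAlgebra

namespace PluckerQuadric

open CliffordAlgebra (contractLeft contractLeft_ι_mul contractLeft_ι)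

variable {K V : Type*} [Field K] [AddCommGroup V] [Module K V]

theorem ι_mul_ι_comm (x y : V) :
    ι K x * ι K y = -(ι K y * ι K x) :=
  eq_neg_of_add_eq_zero_left (ι_add_mul_swap x y)

@[elab_as_elim]
theorem induction_exteriorPower_two {P : ExteriorAlgebra K V → Prop}
    (hι : ∀ x y : V, P (ι K x * ι K y)) (hadd : ∀ w z, P w → P z → P (w + z))
    {w : ExteriorAlgebra K V} (hw : w ∈ ⋀[K]^2 V) : P w := by
  change w ∈ LinearMap.range (ι K) ^ 2 at hw
  rw [pow_two] at hw
  refine Submodule.mul_induction_on hw ?_ hadd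
  rintro _ ⟨x, rfl⟩ _ ⟨y, rfl⟩
  exact hι x y

theorem exists_contractLeft_eq_ι (f : Module.Dual K V) {w : ExteriorAlgebra K V}
    (hw : w ∈ ⋀[K]^2 V) : ∃ x : V, contractLeft f w = ι K x := by
  refine induction_exteriorPower_two (fun x y => ⟨f x • y - f y • x, ?_⟩) ?_ hw
  · rw [contractLeft_ι_mul, contractLeft_ι, ← Algebra.commutes, ← Algebra.smul_def]
    simp
  · rintro w z ⟨x, hx⟩ ⟨y, hy⟩
    exact ⟨x + y, by simp [hx, hy]⟩

theorem ι_mul_comm_of_mem (u : V) {w : ExteriorAlgebra K V} (hw : w ∈ ⋀[K]^2 V) :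
    w * ι K u = ι K u * w := by
  refine induction_exteriorPower_two (fun x y => ?_) ?_ hw
  · rw [mul_assoc, ι_mul_ι_comm y u, mul_neg, ← mul_assoc, ι_mul_ι_comm x u, neg_mul, neg_neg,
      mul_assoc]
  · intro w z h h'
    rw [add_mul, mul_add, h, h']

theorem contractLeft_mul_of_mem (f : Module.Dual K V) {w : ExteriorAlgebra K V}
    (hw : w ∈ ⋀[K]^2 V) (z : ExteriorAlgebra K V) :
    contractLeft f (w * z) = contractLeft f w * z + w * contractLeft f z := by
  refine induction_exteriorPower_two (fun x y => ?_) ?_ hw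
  · rw [mul_assoc, contractLeft_ι_mul, contractLeft_ι_mul, contractLeft_ι_mul, contractLeft_ι,
      ← Algebra.commutes, ← Algebra.smul_def, mul_sub, sub_mul, mul_smul_comm, smul_mul_assoc,
      smul_mul_assoc, mul_assoc]
    abel
  · intro w z h h'
    simp only [add_mul, map_add, h, h']
    abel

/-- If `u ∧ w = 0` and `g u = 1` then `w = u ∧ (g ⌋ w)`. -/
theorem eq_ι_mul_contractLeft {u : V} {g : Module.Dual K V} (hg : g u = 1)
    {w : ExteriorAlgebra K V} (h : ι K u * w = 0) : w = ι K u * contractLeft g w := by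
  have h2 := contractLeft_ι_mul (Q := (0 : QuadraticForm K V)) (d := g) u w
  rw [show CliffordAlgebra.ι (0 : QuadraticForm K V) u * w = 0 from h, map_zero, hg,
    one_smul] at h2
  exact sub_eq_zero.mp h2.symm

theorem exists_eq_ι_mul_ι {u : V} (hu : u ≠ 0) {w : ExteriorAlgebra K V} (hw : w ∈ ⋀[K]^2 V)
    (h : ι K u * w = 0) : ∃ y : V, w = ι K u * ι K y := by
  obtain ⟨g, hg⟩ := Module.Projective.exists_dual_eq_one K hu
  obtain ⟨y, hy⟩ := exists_contractLeft_eq_ι g hw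
  exact ⟨y, hy ▸ eq_ι_mul_contractLeft hg h⟩

theorem exists_eq_smul_of_ι_mul_ι_eq_zero {u x : V} (hu : u ≠ 0) (h : ι K u * ι K x = 0) :
    ∃ k : K, x = k • u := by
  obtain ⟨g, hg⟩ := Module.Projective.exists_dual_eq_one K hu
  refine ⟨g x, (ι_inj K _ _).mp ?_⟩
  have := eq_ι_mul_contractLeft hg h
  rwa [contractLeft_ι, ← Algebra.commutes, ← Algebra.smul_def, ← map_smul] at this

theorem linearIndependent_pair_of_ι_mul_ι_ne_zero {a b : V} (h : ι K a * ι K b ≠ 0) :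
    LinearIndependent K ![a, b] := by
  rw [LinearIndependent.pair_iff]
  intro s t hst
  have h1 : t • (ι K a * ι K b) = 0 := by
    have := congrArg (fun z => ι K a * ι K z) hst
    simpa [mul_add] using this
  have h2 : s • (ι K a * ι K b) = 0 := by
    have := congrArg (fun z => ι K z * ι K b) hst
    simpa [add_mul] using this
  simpa [h] using And.intro h2 h1

/-- A bivector annihilated by two independent vectors is a multiple of their wedge product. -/
theorem exists_eq_smul_ι_mul_ι {a b : V} (hab : LinearIndependent K ![a, b])
    {w : ExteriorAlgebra K V} (hw : w ∈ ⋀[K]^2 V) (ha : ι K a * w = 0) (hb : ι K b * w = 0) :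
    ∃ k : K, w = k • (ι K a * ι K b) := by
  have ha0 : a ≠ 0 := hab.ne_zero 0
  obtain ⟨y, rfl⟩ := exists_eq_ι_mul_ι ha0 hw ha
  obtain ⟨g, hg⟩ := Module.Projective.exists_dual_eq_one K ha0
  have hb' : b - g b • a ≠ 0 := by
    intro h
    have := LinearIndependent.pair_iff.mp hab (-g b) 1 (by rw [← h]; module)
    exact one_ne_zero this.2
  have key : ι K (b - g b • a) * ι K (y - g y • a) = 0 := by
    have h := eq_ι_mul_contractLeft hg (w := ι K b * ι K y) (by
      rw [← mul_assoc, ι_mul_ι_comm, neg_mul, mul_assoc, hb, neg_zero])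
    rw [contractLeft_ι_mul, contractLeft_ι, ← Algebra.commutes, ← Algebra.smul_def] at h
    simp only [map_sub, map_smul, sub_mul, mul_sub, smul_mul_assoc, mul_smul_comm,
      ι_sq_zero, smul_zero] at h ⊢
    rw [h, ι_mul_ι_comm b a]
    module
  obtain ⟨k, hk⟩ := exists_eq_smul_of_ι_mul_ι_eq_zero hb' key
  refine ⟨k, ?_⟩
  rw [sub_eq_iff_eq_add.mp hk]
  simp [mul_add, mul_sub]

/-- Euler's identity for bivectors: `∑ eᵢ ∧ (eⁱ ⌋ w) = 2 w`. -/
theorem sum_ι_mul_contractLeft {n : Type*} [Fintype n] (b : Module.Basis n K V)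
    {w : ExteriorAlgebra K V} (hw : w ∈ ⋀[K]^2 V) :
    ∑ i, ι K (b i) * contractLeft (b.coord i) w = (2 : K) • w := by
  refine induction_exteriorPower_two (fun x y => ?_) ?_ hw
  · have hterm : ∀ i, ι K (b i) * contractLeft (b.coord i) (ι K x * ι K y) =
        ι K (b.repr x i • b i) * ι K y - ι K (b.repr y i • b i) * ι K x := by
      intro i
      rw [contractLeft_ι_mul, contractLeft_ι, ← Algebra.commutes, ← Algebra.smul_def]
      simp [mul_sub]
    rw [Finset.sum_congr rfl fun i _ => hterm i, Finset.sum_sub_distrib, ← Finset.sum_mul,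
      ← Finset.sum_mul, ← map_sum, ← map_sum, b.sum_repr, b.sum_repr, ι_mul_ι_comm y x]
    module
  · intro w z h h'
    simp only [map_add, mul_add, Finset.sum_add_distrib, h, h', smul_add]

/-- A bivector with `w ∧ w = 0` is decomposable. -/
theorem exists_eq_ι_mul_ι_of_mul_self_eq_zero [FiniteDimensional K V] (h2 : (2 : K) ≠ 0)
    {w : ExteriorAlgebra K V} (hw : w ∈ ⋀[K]^2 V) (h : w * w = 0) :
    ∃ x y : V, w = ι K x * ι K y := by
  by_cases hf : ∀ f : Module.Dual K V, contractLeft f w = 0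
  · have := sum_ι_mul_contractLeft (Module.finBasis K V) hw
    simp only [hf, mul_zero, Finset.sum_const_zero] at this
    exact ⟨0, 0, by simpa [h2] using this.symm⟩
  · push Not at hf
    obtain ⟨f, hf⟩ := hf
    obtain ⟨u, hu⟩ := exists_contractLeft_eq_ι f hw
    have h3 := contractLeft_mul_of_mem f hw w
    rw [h, map_zero, hu, ι_mul_comm_of_mem u hw, ← two_smul K] at h3
    have hu0 : u ≠ 0 := by
      rintro rfl
      exact hf (by rw [hu, map_zero])
    exact ⟨u, exists_eq_ι_mul_ι hu0 hw (by simpa [h2] using h3.symm)⟩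

theorem ι_mul_four_eq_ιMulti (v : Fin 4 → V) :
    ι K (v 0) * ι K (v 1) * (ι K (v 2) * ι K (v 3)) = ιMulti K 4 v := by
  simp [ιMulti_apply, mul_assoc]
  rfl

theorem exists_sum_smul_eq_zero {v : Fin 4 → Fin 4 → K}
    (h : ι K (v 0) * ι K (v 1) * (ι K (v 2) * ι K (v 3)) = 0) :
    ∃ k : Fin 4 → K, k ≠ 0 ∧ ∑ i, k i • v i = 0 := by
  rw [ι_mul_four_eq_ιMulti] at h
  have hdet : (Matrix.of v).det = 0 := by
    have := congrArg (liftAlternating (Pi.single 4 (Matrix.detRowAlternating (R := K)))) h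
    rw [liftAlternating_apply_ιMulti, map_zero] at this
    rwa [Pi.single_eq_same] at this
  obtain ⟨k, hk, hv⟩ := Matrix.exists_vecMul_eq_zero_iff.mpr hdet
  refine ⟨k, hk, ?_⟩
  rw [← hv, Matrix.vecMul_eq_sum]
  rfl

/-- Two lines in projective three-space whose Plücker vectors are orthogonal meet in a point. -/
theorem exists_common_point (h2 : (2 : K) ≠ 0) {w z : ExteriorAlgebra K (Fin 4 → K)}
    (hw : w ∈ ⋀[K]^2 (Fin 4 → K)) (hz : z ∈ ⋀[K]^2 (Fin 4 → K)) (hw0 : w ≠ 0) (hz0 : z ≠ 0)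
    (hww : w * w = 0) (hzz : z * z = 0) (hwz : w * z = 0) :
    ∃ t : Fin 4 → K, t ≠ 0 ∧ ι K t * w = 0 ∧ ι K t * z = 0 := by
  obtain ⟨a, b, rfl⟩ := exists_eq_ι_mul_ι_of_mul_self_eq_zero h2 hw hww
  obtain ⟨c, d, rfl⟩ := exists_eq_ι_mul_ι_of_mul_self_eq_zero h2 hz hzz
  have annihilates : ∀ (p q : K) (x y : Fin 4 → K),
      ι K (p • x + q • y) * (ι K x * ι K y) = 0 := by
    intro p q x y
    rw [← mul_assoc, map_add, add_mul, map_smul, map_smul, smul_mul_assoc, ι_sq_zero, smul_zero,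
      zero_add, smul_mul_assoc, ι_mul_ι_comm y x, smul_mul_assoc, neg_mul, mul_assoc, ι_sq_zero]
    simp
  obtain ⟨k, hk, hsum⟩ := exists_sum_smul_eq_zero (v := ![a, b, c, d]) hwz
  simp only [Fin.sum_univ_four, Matrix.cons_val] at hsum
  have ht : k 0 • a + k 1 • b = (-k 2) • c + (-k 3) • d := by
    rw [← sub_eq_zero, ← hsum]
    module
  refine ⟨k 0 • a + k 1 • b, fun h0 => hk ?_, annihilates _ _ _ _, ?_⟩
  · obtain ⟨h0a, h0b⟩ := LinearIndependent.pair_iff.mp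
      (linearIndependent_pair_of_ι_mul_ι_ne_zero hw0) _ _ h0
    obtain ⟨h0c, h0d⟩ := LinearIndependent.pair_iff.mp
      (linearIndependent_pair_of_ι_mul_ι_ne_zero hz0) _ _ (ht.symm.trans h0)
    funext i
    fin_cases i
    · exact h0a
    · exact h0b
    · exact neg_eq_zero.mp h0c
    · exact neg_eq_zero.mp h0d
  · rw [ht]
    exact annihilates _ _ _ _

/-- The linear map `x ↦ v ∧ x`. -/
noncomputable def wedgeLeft (v : V) : V →ₗ[K] ExteriorAlgebra K V :=
  LinearMap.mulLeft K (ι K v) ∘ₗ ι K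

theorem wedgeLeft_apply (v x : V) : wedgeLeft v x = ι K v * ι K x := rfl

theorem finrank_range_wedgeLeft_lt [FiniteDimensional K V] {v : V} (hv : v ≠ 0) :
    Module.finrank K (LinearMap.range (wedgeLeft (K := K) v)) < Module.finrank K V := by
  have h := LinearMap.finrank_range_add_finrank_ker (wedgeLeft (K := K) v)
  have hmem : v ∈ LinearMap.ker (wedgeLeft (K := K) v) := by
    simp [wedgeLeft_apply]
  have hpos : 0 < Module.finrank K (LinearMap.ker (wedgeLeft (K := K) v)) :=
    Module.finrank_pos_iff_exists_ne_zero.mpr ⟨⟨v, hmem⟩, fun h => hv (congrArg Subtype.val h)⟩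
  omega

/-- The image of `⋀²H` in the exterior algebra. -/
def wedgeSquare (H : Submodule K V) : Submodule K (ExteriorAlgebra K V) :=
  Submodule.span K {w | ∃ x ∈ H, ∃ y ∈ H, w = ι K x * ι K y}

theorem wedgeSquare_span_triple_le (a b c : V) :
    wedgeSquare (Submodule.span K {a, b, c}) ≤
      Submodule.span K {ι K a * ι K b, ι K a * ι K c, ι K b * ι K c} := by
  refine Submodule.span_le.mpr ?_
  rintro _ ⟨x, hx, y, hy, rfl⟩
  obtain ⟨p, q, r, rfl⟩ := Submodule.mem_span_triple.mp hx
  obtain ⟨p', q', r', rfl⟩ := Submodule.mem_span_triple.mp hy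
  refine Submodule.mem_span_triple.mpr
    ⟨p * q' - q * p', p * r' - r * p', q * r' - r * q', ?_⟩
  simp only [map_add, map_smul, add_mul, mul_add, smul_mul_assoc, mul_smul_comm, ι_sq_zero,
    smul_zero, ι_mul_ι_comm b a, ι_mul_ι_comm c a, ι_mul_ι_comm c b]
  module

theorem finrank_span_triple_le {W : Type*} [AddCommGroup W] [Module K W] (a b c : W) :
    Module.finrank K (Submodule.span K {a, b, c}) ≤ 3 := by
  classical
  have h := finrank_span_finset_le_card (R := K) ({a, b, c} : Finset W)
  simp only [Finset.coe_insert, Finset.coe_singleton] at h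
  exact h.trans Finset.card_le_three

theorem mul_eq_zero_of_mem_wedgeSquare {H : Submodule K V} [FiniteDimensional K H]
    (hH : Module.finrank K H < 4) {w z : ExteriorAlgebra K V} (hw : w ∈ wedgeSquare H)
    (hz : z ∈ wedgeSquare H) : w * z = 0 := by
  have hle : wedgeSquare H * wedgeSquare H ≤ ⊥ := by
    rw [wedgeSquare, Submodule.span_mul_span, Submodule.span_le]
    rintro _ ⟨_, ⟨x, hx, y, hy, rfl⟩, _, ⟨x', hx', y', hy', rfl⟩, rfl⟩
    change ι K x * ι K y * (ι K x' * ι K y') = 0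
    have hdep : ¬ LinearIndependent K ![x, y, x', y'] := by
      intro hli
      let s : Fin 4 → H := ![⟨x, hx⟩, ⟨y, hy⟩, ⟨x', hx'⟩, ⟨y', hy'⟩]
      have hs : ![x, y, x', y'] = H.subtype ∘ s := by
        funext i
        fin_cases i <;> rfl
      have hcard := (LinearIndependent.of_comp H.subtype (hs ▸ hli)).fintype_card_le_finrank
      simp only [Fintype.card_fin] at hcard
      omega
    exact (ι_mul_four_eq_ιMulti ![x, y, x', y']).trans
      ((ιMulti K 4).map_linearDependent _ hdep)
  exact (Submodule.mem_bot K).mp (hle (Submodule.mul_mem_mul hw hz))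

/-- A three-dimensional totally isotropic space of bivectors consists of the lines through a point
or of the lines in a plane. -/
theorem eq_range_wedgeLeft_or_eq_wedgeSquare (h2 : (2 : K) ≠ 0)
    {M : Submodule K (ExteriorAlgebra K (Fin 4 → K))} (hM : M ≤ ⋀[K]^2 (Fin 4 → K))
    (hdim : Module.finrank K M = 3) (hiso : ∀ w ∈ M, ∀ z ∈ M, w * z = 0) :
    (∃ v : Fin 4 → K, v ≠ 0 ∧ M = LinearMap.range (wedgeLeft v)) ∨
      ∃ H : Submodule K (Fin 4 → K), Module.finrank K H = 3 ∧ M = wedgeSquare H := by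
  have : FiniteDimensional K M := Module.finite_of_finrank_eq_succ hdim
  let β := Module.finBasisOfFinrankEq K M hdim
  have hmem : ∀ i, (β i : ExteriorAlgebra K (Fin 4 → K)) ∈ M := fun i => (β i).2
  have hpow := fun i => hM (hmem i)
  have hne : ∀ i, (β i : ExteriorAlgebra K (Fin 4 → K)) ≠ 0 := fun i h =>
    β.ne_zero i (Subtype.ext h)
  have hle : ∀ {N : Submodule K (ExteriorAlgebra K (Fin 4 → K))},
      (∀ i, (β i : ExteriorAlgebra K (Fin 4 → K)) ∈ N) → M ≤ N := by
    intro N hN w hw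
    have hsum := congrArg Subtype.val (β.sum_repr ⟨w, hw⟩)
    rw [← show _ = w from hsum, AddSubmonoidClass.coe_finsetSum]
    exact N.sum_mem fun i _ => N.smul_mem _ (hN i)
  have hmeet := fun i j => exists_common_point h2 (hpow i) (hpow j) (hne i) (hne j)
    (hiso _ (hmem i) _ (hmem i)) (hiso _ (hmem j) _ (hmem j)) (hiso _ (hmem i) _ (hmem j))
  have hpoint : ∀ t : Fin 4 → K, t ≠ 0 →
      (∀ i, ι K t * (β i : ExteriorAlgebra K (Fin 4 → K)) = 0) →
      M = LinearMap.range (wedgeLeft t) := by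
    intro t ht h
    refine Submodule.eq_of_le_of_finrank_le (hle fun i => ?_) ?_
    · obtain ⟨y, hy⟩ := exists_eq_ι_mul_ι ht (hpow i) (h i)
      exact ⟨y, hy.symm⟩
    · have := finrank_range_wedgeLeft_lt (K := K) ht
      rw [Module.finrank_fin_fun] at this
      omega
  obtain ⟨a, ha0, ha, ha'⟩ := hmeet 0 1
  obtain ⟨b, hb0, hb, hb'⟩ := hmeet 0 2
  obtain ⟨c, hc0, hc, hc'⟩ := hmeet 1 2
  by_cases haw : ι K a * (β 2 : ExteriorAlgebra K (Fin 4 → K)) = 0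
  · exact Or.inl ⟨a, ha0, hpoint a ha0
      (Fin.forall_fin_succ.mpr ⟨ha, Fin.forall_fin_two.mpr ⟨ha', haw⟩⟩)⟩
  by_cases hbw : ι K b * (β 1 : ExteriorAlgebra K (Fin 4 → K)) = 0
  · exact Or.inl ⟨b, hb0, hpoint b hb0
      (Fin.forall_fin_succ.mpr ⟨hb, Fin.forall_fin_two.mpr ⟨hbw, hb'⟩⟩)⟩
  by_cases hcw : ι K c * (β 0 : ExteriorAlgebra K (Fin 4 → K)) = 0
  · exact Or.inl ⟨c, hc0, hpoint c hc0
      (Fin.forall_fin_succ.mpr ⟨hcw, Fin.forall_fin_two.mpr ⟨hc, hc'⟩⟩)⟩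
  right
  have hli : LinearIndependent K ![a, b, c] := by
    rw [Fintype.linearIndependent_iff]
    intro k h
    simp only [Fin.sum_univ_three, Matrix.cons_val] at h
    have hmul := fun i => congrArg (fun x => ι K x * (β i : ExteriorAlgebra K (Fin 4 → K))) h
    have h0 := hmul 0
    have h1 := hmul 1
    have h3 := hmul 2
    simp only [map_add, map_smul, add_mul, smul_mul_assoc, ha, ha', hb, hb', hc, hc', smul_zero,
      add_zero, zero_add, map_zero, zero_mul, smul_eq_zero, haw, hbw, hcw, or_false] at h0 h1 h3
    exact Fin.forall_fin_succ.mpr ⟨h3, Fin.forall_fin_two.mpr ⟨h1, h0⟩⟩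
  have hpair : ∀ i j, i ≠ j → LinearIndependent K ![![a, b, c] i, ![a, b, c] j] := by
    intro i j hij
    have hinj : Function.Injective ![i, j] := by
      intro x y
      fin_cases x <;> fin_cases y <;> simp [hij, hij.symm]
    convert hli.comp _ hinj using 1
    funext x
    fin_cases x <;> rfl
  have hrange : Set.range ![a, b, c] = {a, b, c} := by
    rw [Matrix.range_cons, Matrix.range_cons_cons_empty, Set.singleton_union]
  have hfin := finrank_span_eq_card hli
  rw [hrange, Fintype.card_fin] at hfin
  refine ⟨Submodule.span K {a, b, c}, hfin, ?_⟩
  have hbound := wedgeSquare_span_triple_le (K := K) a b c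
  have : FiniteDimensional K (wedgeSquare (Submodule.span K {a, b, c})) :=
    have := FiniteDimensional.span_of_finite K
      (Set.toFinite {ι K a * ι K b, ι K a * ι K c, ι K b * ι K c})
    Submodule.finiteDimensional_of_le hbound
  have hwedge : ∀ {x y}, x ∈ ({a, b, c} : Set (Fin 4 → K)) → y ∈ ({a, b, c} : Set (Fin 4 → K)) →
      ∀ {w}, (∃ k : K, w = k • (ι K x * ι K y)) →
        w ∈ wedgeSquare (Submodule.span K {a, b, c}) := by
    rintro x y hx hy _ ⟨k, rfl⟩
    exact Submodule.smul_mem _ _ (Submodule.subset_span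
      ⟨x, Submodule.subset_span hx, y, Submodule.subset_span hy, rfl⟩)
  refine Submodule.eq_of_le_of_finrank_le (hle fun i => ?_) ?_
  · fin_cases i
    · exact hwedge (by simp) (by simp)
        (exists_eq_smul_ι_mul_ι (hpair 0 1 (by decide)) (hpow 0) ha hb)
    · exact hwedge (by simp) (by simp)
        (exists_eq_smul_ι_mul_ι (hpair 0 2 (by decide)) (hpow 1) ha' hc)
    · exact hwedge (by simp) (by simp)
        (exists_eq_smul_ι_mul_ι (hpair 1 2 (by decide)) (hpow 2) hb' hc')
  · rw [hdim]
    have := FiniteDimensional.span_of_finite K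
      (Set.toFinite {ι K a * ι K b, ι K a * ι K c, ι K b * ι K c})
    exact (Submodule.finrank_mono hbound).trans (finrank_span_triple_le _ _ _)

end PluckerQuadric

/-- The two families of maximal totally isotropic subspaces of the Plücker quadric
`G : w ∧ w = 0` in `P(⋀²ℂ⁴)`: a 3-dimensional subspace `M ⊆ ⋀²V` (`V = ℂ⁴`) satisfies
`w ∧ w' = 0` for all `w, w' ∈ M` if and only if either `M = {v ∧ x : x ∈ V}` for some
nonzero `v ∈ V` (the family `σ₂(p)` of lines through a point), or `M` is the image of
`⋀²H` for a 3-dimensional subspace `H ⊆ V` (the family `σ₁,₁(h)` of lines in a plane). -/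
theorem plucker_maximal_isotropic_subspaces
    (M : Submodule ℂ (ExteriorAlgebra ℂ (Fin 4 → ℂ)))
    (hM : M ≤ ⋀[ℂ]^2 (Fin 4 → ℂ))
    (hdim : Module.finrank ℂ M = 3) :
    (∀ w ∈ M, ∀ w' ∈ M, w * w' = 0) ↔
    ((∃ v : Fin 4 → ℂ, v ≠ 0 ∧
        (M : Set (ExteriorAlgebra ℂ (Fin 4 → ℂ))) =
          Set.range (fun x : Fin 4 → ℂ => ι ℂ v * ι ℂ x)) ∨
     (∃ H : Submodule ℂ (Fin 4 → ℂ), Module.finrank ℂ H = 3 ∧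
        M = Submodule.span ℂ
          {w : ExteriorAlgebra ℂ (Fin 4 → ℂ) | ∃ x ∈ H, ∃ y ∈ H, w = ι ℂ x * ι ℂ y})) := by
  constructor
  · intro hiso
    obtain ⟨v, hv, h⟩ | h :=
      PluckerQuadric.eq_range_wedgeLeft_or_eq_wedgeSquare two_ne_zero hM hdim hiso
    · exact Or.inl ⟨v, hv, h ▸ rfl⟩
    · exact Or.inr h
  · rintro (⟨v, -, h⟩ | ⟨H, hH, rfl⟩) w hw z hz
    · rw [← SetLike.mem_coe, h] at hw
      obtain ⟨x, rfl⟩ := hw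
      change ι ℂ v * ι ℂ x * z = 0
      have hvz : ι ℂ v * z = 0 := by
        rw [← SetLike.mem_coe, h] at hz
        obtain ⟨y, rfl⟩ := hz
        change ι ℂ v * (ι ℂ v * ι ℂ y) = 0
        rw [← mul_assoc, ι_sq_zero, zero_mul]
      rw [PluckerQuadric.ι_mul_ι_comm, neg_mul, mul_assoc, hvz, mul_zero, neg_zero]
    · exact PluckerQuadric.mul_eq_zero_of_mem_wedgeSquare (by omega) hw hz
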